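/- The critical values of the height function h_I on Sp(n) are the integers n − 2q for 0 ≤ q ≤ n: if A ∈ Sp(n) satisfies A² = I, then there exists a natural number q ≤ n such that re(tr(A)) = n − 2q. -/

import Mathlib

open scoped Quaternion Matrix

theorem Quaternion.re_finset_sum {ι : Type*} (s : Finset ι) (f : ι → ℍ[ℝ]) :
    (∑ i ∈ s, f i).re = ∑ i ∈ s, (f i).re :=
  map_sum (QuaternionAlgebra.reₗ (-1 : ℝ) 0 (-1)) f s

/-- The real part of the trace of a product of quaternionic matrices is cyclic. -/
theorem Quaternion.re_trace_mul_comm {m n : Type*} [Fintype m] [Fintype n]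
    (B : Matrix m n ℍ[ℝ]) (C : Matrix n m ℍ[ℝ]) :
    ((B * C).trace).re = ((C * B).trace).re := by
  simp only [Matrix.trace, Matrix.diag_apply, Matrix.mul_apply, Quaternion.re_finset_sum]
  rw [Finset.sum_comm]
  refine Finset.sum_congr rfl fun i _ => Finset.sum_congr rfl fun j _ => ?_
  simp only [Quaternion.re_mul]
  ring

/-- An idempotent matrix over a division ring factors as `B * C` with `C * B = 1`. -/
theorem Matrix.exists_mul_eq_of_isIdempotentElem {D : Type*} [DivisionRing D] {n : ℕ}
    {P : Matrix (Fin n) (Fin n) D} (hP : IsIdempotentElem P) :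
    ∃ q ≤ n, ∃ (B : Matrix (Fin n) (Fin q) D) (C : Matrix (Fin q) (Fin n) D),
      B * C = P ∧ C * B = 1 := by
  let W : Submodule D (Fin n → D) := LinearMap.range P.vecMulLinear
  let b := Module.finBasis D W
  have hrow (i : Fin n) : P i ∈ W := ⟨Pi.single i 1, by simp [Matrix.row]⟩
  let B : Matrix (Fin n) (Fin (Module.finrank D W)) D :=
    Matrix.of fun i j => b.repr ⟨P i, hrow i⟩ j
  let C : Matrix (Fin (Module.finrank D W)) (Fin n) D := Matrix.of fun i j => (b i : Fin n → D) j
  have hBC : B * C = P := by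
    ext i j
    have h := congrArg (fun w : W => (w : Fin n → D) j) (b.sum_repr ⟨P i, hrow i⟩)
    simpa only [B, C, Matrix.mul_apply, Matrix.of_apply, Submodule.coe_sum, Submodule.coe_smul,
      Finset.sum_apply, Pi.smul_apply, smul_eq_mul] using h
  have hCP : C * P = C := by
    ext i j
    obtain ⟨v, hv⟩ := (b i).2
    have hv' : C i = v ᵥ* P := hv.symm
    rw [Matrix.mul_apply_eq_vecMul, hv', Matrix.vecMul_vecMul, hP.eq]
  refine ⟨Module.finrank D W, ?_, B, C, hBC, ?_⟩
  · simpa using Submodule.finrank_le W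
  · have hli : LinearIndependent D C :=
      b.linearIndependent.map' W.subtype W.ker_subtype
    have hinj := Matrix.vecMul_injective_iff.mpr hli
    refine funext fun i => hinj ?_
    change (C * B) i ᵥ* C = (1 : Matrix _ _ D) i ᵥ* C
    rw [← Matrix.mul_apply_eq_vecMul, ← Matrix.mul_apply_eq_vecMul, Matrix.mul_assoc, hBC, hCP,
      Matrix.one_mul]

theorem criticalValues_height_identity (n : ℕ) (A : Matrix (Fin n) (Fin n) ℍ[ℝ])
    (hA : A * Aᴴ = 1) (hinv : A * A = 1) :
    ∃ q : ℕ, q ≤ n ∧ (A.trace).re = (n : ℝ) - 2 * q := by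
  have hP : IsIdempotentElem ((1 / 2 : ℝ) • (1 - A)) := by
    simp only [IsIdempotentElem, smul_mul_smul_comm, sub_mul, mul_sub, hinv, one_mul, mul_one]
    module
  obtain ⟨q, hq, B, C, hBC, hCB⟩ := Matrix.exists_mul_eq_of_isIdempotentElem hP
  refine ⟨q, hq, ?_⟩
  have h := Quaternion.re_trace_mul_comm B C
  rw [hBC, hCB, Matrix.trace_smul, Matrix.trace_sub, Matrix.trace_one, Matrix.trace_one] at h
  simp at h
  linarith
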